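/- arXiv:math/0212155 — 2 statements merged into one kernel-verified Lean document; each statement's English description precedes it below -/
import Mathlib

section
/- (First multiplication formula.) For any natural number n ≥ 1 and complex numbers z, τ, σ with Im τ > 0 and Im σ > 0, Γ(nz, τ, σ) = ∏_{k₁=0}^{n−1} ∏_{k₂=0}^{n−1} ∏_{k₃=0}^{n−1} Γ(z + (k₁ + k₂τ + k₃σ)/n, τ, σ), for all z where both sides are defined (all denominator factors nonzero). -/
open Complex Real Filter

/-- The q-Pochhammer infinite product `(x; q) = ∏_{j=0}^∞ (1 - x q^j)`. -/
noncomputable def qPoch (x q : ℂ) : ℂ := ∏' j : ℕ, (1 - x * q ^ j)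

/-- The Jacobi theta function `θ₀(z,τ) = (x;q)(q/x;q)` with `x = e^{2πiz}`, `q = e^{2πiτ}`. -/
noncomputable def theta₀ (z τ : ℂ) : ℂ :=
  qPoch (Complex.exp (2 * Real.pi * Complex.I * z)) (Complex.exp (2 * Real.pi * Complex.I * τ)) *
  qPoch (Complex.exp (2 * Real.pi * Complex.I * τ) / Complex.exp (2 * Real.pi * Complex.I * z))
    (Complex.exp (2 * Real.pi * Complex.I * τ))

/-- The elliptic gamma function
`Γ(z,τ,σ) = ∏_{j,k≥0} (1 - e^{2πi((j+1)τ+(k+1)σ-z)}) / (1 - e^{2πi(jτ+kσ+z)})`. -/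
noncomputable def ellipticGamma (z τ σ : ℂ) : ℂ :=
  ∏' p : ℕ × ℕ,
    (1 - Complex.exp (2 * Real.pi * Complex.I *
        (((p.1 : ℂ) + 1) * τ + ((p.2 : ℂ) + 1) * σ - z))) /
    (1 - Complex.exp (2 * Real.pi * Complex.I * ((p.1 : ℂ) * τ + (p.2 : ℂ) * σ + z)))

/-- All denominator factors of the product defining `Γ(z,τ,σ)` are nonzero. -/
def EllipticGammaDefined (z τ σ : ℂ) : Prop :=
  ∀ j k : ℕ, Complex.exp (2 * Real.pi * Complex.I * ((j : ℂ) * τ + (k : ℂ) * σ + z)) ≠ 1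

/-- The normalized elliptic gamma function
`Γ̄(z,τ,σ) = ((q;q)/(r;r)) θ₀(τ,σ)^{1-z} Γ(zτ,τ,σ)` with `q = e^{2πiτ}`, `r = e^{2πiσ}`;
the power is the principal-branch complex power. -/
noncomputable def ellipticGammaBar (z τ σ : ℂ) : ℂ :=
  (qPoch (Complex.exp (2 * Real.pi * Complex.I * τ)) (Complex.exp (2 * Real.pi * Complex.I * τ)) /
   qPoch (Complex.exp (2 * Real.pi * Complex.I * σ)) (Complex.exp (2 * Real.pi * Complex.I * σ))) *
  theta₀ τ σ ^ (1 - z) * ellipticGamma (z * τ) τ σ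

/-- Jackson's q-gamma function `Γ_q(z) = (1-q)^{1-z} (q;q)/(q^z;q)`, `q = e^{2πiτ}`,
with principal-branch powers. -/
noncomputable def qGammaTrig (z τ : ℂ) : ℂ :=
  (1 - Complex.exp (2 * Real.pi * Complex.I * τ)) ^ (1 - z) *
    qPoch (Complex.exp (2 * Real.pi * Complex.I * τ)) (Complex.exp (2 * Real.pi * Complex.I * τ)) /
    qPoch (Complex.exp (2 * Real.pi * Complex.I * τ * z)) (Complex.exp (2 * Real.pi * Complex.I * τ))

/-- An unconditionally convergent product over `ℕ × ℕ` splits along residue classes modulo `n`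
in both coordinates. -/
theorem tprod_nat_prod_eq_prod_range_tprod {α : Type*} [CommMonoid α] [TopologicalSpace α]
    [ContinuousMul α] [T3Space α] (n : ℕ) (hn : 0 < n) {F : ℕ × ℕ → α} (hF : Multipliable F)
    (hres : ∀ a b : ℕ, Multipliable fun p : ℕ × ℕ ↦ F (p.1 * n + a, p.2 * n + b)) :
    ∏' p, F p = ∏ a ∈ Finset.range n, ∏ b ∈ Finset.range n,
      ∏' p : ℕ × ℕ, F (p.1 * n + a, p.2 * n + b) := by
  have : NeZero n := ⟨hn.ne'⟩
  let e : (Fin n × Fin n) × (ℕ × ℕ) ≃ ℕ × ℕ :=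
    (Equiv.prodComm _ _).trans ((Equiv.prodProdProdComm ℕ ℕ (Fin n) (Fin n)).trans
      ((Nat.divModEquiv n).symm.prodCongr (Nat.divModEquiv n).symm))
  have h := (e.hasProd_iff.mpr hF.hasProd).prod_fiberwise
    (g := fun c : Fin n × Fin n ↦
      ∏' p : ℕ × ℕ, F (p.1 * n + (c.1 : ℕ), p.2 * n + (c.2 : ℕ))) fun c ↦ (hres c.1 c.2).hasProd
  rw [h.unique (hasProd_fintype _), Fintype.prod_prod_type, Finset.prod_range]
  exact Finset.prod_congr rfl fun a _ ↦ (Finset.prod_range fun b ↦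
    ∏' p : ℕ × ℕ, F (p.1 * n + (a : ℕ), p.2 * n + b)).symm

/-- The multiplication formula for `1 - exp (2πiu)`, i.e. the factorization of `1 - xⁿ` over the
`n`-th roots of unity. -/
theorem one_sub_exp_two_pi_mul_nat_mul (n : ℕ) (hn : 0 < n) (u : ℂ) :
    1 - Complex.exp (2 * Real.pi * Complex.I * (n * u)) =
      ∏ k ∈ Finset.range n, (1 - Complex.exp (2 * Real.pi * Complex.I * (u + k / n))) := by
  have h := congrArg (Polynomial.eval 1) (X_pow_sub_C_eq_prod
    (Complex.isPrimitiveRoot_exp n hn.ne') hn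
    (rfl : Complex.exp (2 * Real.pi * Complex.I * u) ^ n = _))
  simp only [Polynomial.eval_sub, Polynomial.eval_pow, Polynomial.eval_X, Polynomial.eval_C,
    one_pow, Polynomial.eval_prod] at h
  rw [← Complex.exp_nat_mul] at h
  convert h using 2
  · ring_nf
  · rw [← Complex.exp_nat_mul, ← Complex.exp_add]
    ring_nf

theorem norm_exp_two_pi_I_mul_lt_one {τ : ℂ} (hτ : 0 < τ.im) :
    ‖Complex.exp (2 * Real.pi * Complex.I * τ)‖ < 1 := by
  rw [Complex.norm_exp, Real.exp_lt_one_iff]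
  have : 0 < 2 * Real.pi * τ.im := by positivity
  simpa using this

theorem summable_norm_neg_exp_double {τ σ : ℂ} (hτ : 0 < τ.im) (hσ : 0 < σ.im) (w : ℂ) :
    Summable fun p : ℕ × ℕ ↦
      ‖-Complex.exp (2 * Real.pi * Complex.I * ((p.1 : ℂ) * τ + (p.2 : ℂ) * σ + w))‖ := by
  have h := (((summable_norm_geometric_of_norm_lt_one (norm_exp_two_pi_I_mul_lt_one hτ)).mul_norm
    (summable_norm_geometric_of_norm_lt_one (norm_exp_two_pi_I_mul_lt_one hσ))).mul_right
      ‖Complex.exp (2 * Real.pi * Complex.I * w)‖)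
  refine h.congr fun p ↦ ?_
  rw [norm_neg, ← norm_mul, ← Complex.exp_nat_mul, ← Complex.exp_nat_mul, ← Complex.exp_add,
    ← Complex.exp_add]
  ring_nf

/-- The double infinite product `∏_{j,k≥0} (1 - e^{2πi(jτ+kσ+w)})`. -/
noncomputable def doublePoch (w τ σ : ℂ) : ℂ :=
  ∏' p : ℕ × ℕ, (1 - Complex.exp (2 * Real.pi * Complex.I * ((p.1 : ℂ) * τ + (p.2 : ℂ) * σ + w)))

theorem multipliable_doublePoch {τ σ : ℂ} (hτ : 0 < τ.im) (hσ : 0 < σ.im) (w : ℂ) :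
    Multipliable fun p : ℕ × ℕ ↦
      (1 - Complex.exp (2 * Real.pi * Complex.I * ((p.1 : ℂ) * τ + (p.2 : ℂ) * σ + w))) := by
  simpa only [sub_eq_add_neg] using
    multipliable_one_add_of_summable (summable_norm_neg_exp_double hτ hσ w)

theorem doublePoch_ne_zero {τ σ : ℂ} (hτ : 0 < τ.im) (hσ : 0 < σ.im) {w : ℂ}
    (hw : EllipticGammaDefined w τ σ) : doublePoch w τ σ ≠ 0 := by
  simp only [doublePoch, sub_eq_add_neg]
  refine tprod_one_add_ne_zero_of_summable (fun p ↦ ?_) (summable_norm_neg_exp_double hτ hσ w)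
  rw [← sub_eq_add_neg]
  exact sub_ne_zero.mpr (hw p.1 p.2).symm

theorem ellipticGamma_eq_div {τ σ : ℂ} (hτ : 0 < τ.im) (hσ : 0 < σ.im) {z : ℂ}
    (hz : EllipticGammaDefined z τ σ) :
    ellipticGamma z τ σ = doublePoch (τ + σ - z) τ σ / doublePoch z τ σ := by
  refine Eq.trans (tprod_congr fun p ↦ ?_)
    ((multipliable_doublePoch hτ hσ (τ + σ - z)).hasProd.div₀
      (multipliable_doublePoch hτ hσ z).hasProd (doublePoch_ne_zero hτ hσ hz)).tprod_eq
  ring_nf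

theorem doublePoch_sub_natCast (w τ σ : ℂ) (m : ℕ) :
    doublePoch (w - m) τ σ = doublePoch w τ σ := by
  refine tprod_congr fun p ↦ ?_
  rw [← Complex.exp_periodic.sub_nat_mul_eq (x := 2 * Real.pi * Complex.I * (_ + w)) m]
  ring_nf

theorem doublePoch_nat_mul (n : ℕ) (hn : 0 < n) {τ σ : ℂ} (hτ : 0 < τ.im) (hσ : 0 < σ.im)
    (w : ℂ) :
    doublePoch (n * w) τ σ =
      ∏ k₁ ∈ Finset.range n, ∏ k₂ ∈ Finset.range n, ∏ k₃ ∈ Finset.range n,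
        doublePoch (w + ((k₁ : ℂ) + (k₂ : ℂ) * τ + (k₃ : ℂ) * σ) / n) τ σ := by
  have hn' : (n : ℂ) ≠ 0 := Nat.cast_ne_zero.mpr hn.ne'
  have factor (a b : ℕ) (p : ℕ × ℕ) :
      1 - Complex.exp (2 * Real.pi * Complex.I *
        (((p.1 * n + a : ℕ) : ℂ) * τ + ((p.2 * n + b : ℕ) : ℂ) * σ + n * w)) =
      ∏ k ∈ Finset.range n, (1 - Complex.exp (2 * Real.pi * Complex.I *
        ((p.1 : ℂ) * τ + (p.2 : ℂ) * σ + (w + ((k : ℂ) + (a : ℂ) * τ + (b : ℂ) * σ) / n)))) := by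
    convert one_sub_exp_two_pi_mul_nat_mul n hn
      (p.1 * τ + p.2 * σ + w + (a * τ + b * σ) / n) using 4
    · push_cast
      field_simp
      ring
    · ring
  have fiber (a b : ℕ) := hasProd_prod (s := Finset.range n) fun k _ ↦
    (multipliable_doublePoch hτ hσ
      (w + ((k : ℂ) + (a : ℂ) * τ + (b : ℂ) * σ) / n)).hasProd
  simp only [← factor] at fiber
  rw [doublePoch, tprod_nat_prod_eq_prod_range_tprod n hn
    (multipliable_doublePoch hτ hσ _)
    fun a b ↦ (fiber a b).multipliable]
  simp only [(fiber _ _).tprod_eq]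
  rw [eq_comm, Finset.prod_comm]
  exact Finset.prod_congr rfl fun _ _ ↦ Finset.prod_comm

/-- the first multiplication formula
`Γ(nz,τ,σ) = ∏_{k₁,k₂,k₃=0}^{n-1} Γ(z + (k₁+k₂τ+k₃σ)/n, τ, σ)`. -/
theorem ellipticGamma_first_multiplication (n : ℕ) (hn : 1 ≤ n) (z τ σ : ℂ)
    (hτ : 0 < τ.im) (hσ : 0 < σ.im)
    (h0 : EllipticGammaDefined ((n : ℂ) * z) τ σ)
    (h1 : ∀ k₁ k₂ k₃ : ℕ, k₁ < n → k₂ < n → k₃ < n →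
      EllipticGammaDefined (z + ((k₁ : ℂ) + (k₂ : ℂ) * τ + (k₃ : ℂ) * σ) / n) τ σ) :
    ellipticGamma ((n : ℂ) * z) τ σ =
      ∏ k₁ ∈ Finset.range n, ∏ k₂ ∈ Finset.range n, ∏ k₃ ∈ Finset.range n,
        ellipticGamma (z + ((k₁ : ℂ) + (k₂ : ℂ) * τ + (k₃ : ℂ) * σ) / n) τ σ := by
  have hn' : (n : ℂ) ≠ 0 := Nat.cast_ne_zero.mpr (by omega)
  have numerator : doublePoch (τ + σ - n * z) τ σ =
      ∏ k₁ ∈ Finset.range n, ∏ k₂ ∈ Finset.range n, ∏ k₃ ∈ Finset.range n,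
        doublePoch (τ + σ - (z + ((k₁ : ℂ) + (k₂ : ℂ) * τ + (k₃ : ℂ) * σ) / n)) τ σ := by
    have shift : τ + σ - n * z - (n - 1 : ℕ) =
        n * (τ + σ - z - (n - 1) * (1 + τ + σ) / n) := by
      push_cast [hn]
      field_simp
      ring
    rw [← doublePoch_sub_natCast _ _ _ (n - 1), shift, doublePoch_nat_mul n hn hτ hσ,
      ← Finset.prod_range_reflect]
    refine Finset.prod_congr rfl fun k₁ h₁ ↦ ?_
    rw [← Finset.prod_range_reflect]
    refine Finset.prod_congr rfl fun k₂ h₂ ↦ ?_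
    rw [← Finset.prod_range_reflect]
    refine Finset.prod_congr rfl fun k₃ h₃ ↦ ?_
    have reflect {k : ℕ} (hk : k ∈ Finset.range n) : ((n - 1 - k : ℕ) : ℂ) = n - 1 - k := by
      rw [Nat.cast_sub (Nat.le_sub_one_of_lt (Finset.mem_range.mp hk)), Nat.cast_pred hn]
    rw [reflect h₁, reflect h₂, reflect h₃]
    congr 1
    field_simp
    ring
  rw [ellipticGamma_eq_div hτ hσ h0, numerator, doublePoch_nat_mul n hn hτ hσ]
  simp only [← Finset.prod_div_distrib]
  refine Finset.prod_congr rfl fun k₁ h₁ ↦ Finset.prod_congr rfl fun k₂ h₂ ↦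
    Finset.prod_congr rfl fun k₃ h₃ ↦ ?_
  exact (ellipticGamma_eq_div hτ hσ (h1 k₁ k₂ k₃ (Finset.mem_range.mp h₁)
    (Finset.mem_range.mp h₂) (Finset.mem_range.mp h₃))).symm
end

section
/- For a fixed complex number z that is not a nonpositive integer, Jackson's q-gamma function degenerates to the Euler gamma function in the rational limit: Γ_trig(z, i s) → Γ(z) as the real parameter s → 0⁺ (i.e., τ = i s tends to 0 along the positive imaginary axis, so that q = e^{−2πs} → 1⁻), where Γ(z) is the Euler gamma function. -/
open Complex Real Filter

open scoped Topology

/-- The `q`-integer `[z] = (1 - q^z) / (1 - q)` at `q = e^{-h}`. -/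
noncomputable def qNumber (z : ℂ) (h : ℝ) : ℂ :=
  (1 - Complex.exp (-(h * z))) / (1 - Complex.exp (-h))

/-- The quantity `q^n / [n]` at `q = e^{-h}`; it tends to `1 / n` as `h → 0`. -/
noncomputable def qStep (h n : ℝ) : ℝ := (1 - Real.exp (-h)) / (Real.exp (h * n) - 1)

/-- The factor `(1 + d A) (1 + d)^{-z}` of the Euler product for the reciprocal Gamma function. -/
noncomputable def eulerFactor (z A : ℂ) (d : ℝ) : ℂ :=
  (1 + d * A) * Complex.exp (-(z * (Real.log (1 + d) : ℝ)))

lemma norm_eulerFactor_sub_one_le {z A : ℂ} {d : ℝ} (hd0 : 0 ≤ d) (hd1 : d ≤ 1)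
    (hA : ‖A‖ ≤ ‖z‖ + 1) :
    ‖eulerFactor z A d - 1‖ ≤ ‖A - z‖ * d +
      (‖z‖ + ‖z‖ ^ 2 * Real.exp ‖z‖ + (‖z‖ + 1) * (‖z‖ + ‖z‖ ^ 2 * Real.exp ‖z‖)) * d ^ 2 := by
  set L := Real.log (1 + d) with hL
  have hL0 : 0 ≤ L := Real.log_nonneg (by linarith)
  have hLd : L ≤ d := by
    have := Real.log_le_sub_one_of_pos (show 0 < 1 + d by linarith); linarith
  have hdL : d - L ≤ d ^ 2 := by
    have h1 := Real.one_sub_inv_le_log_of_pos (show 0 < 1 + d by linarith)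
    have h2 : (1 + d)⁻¹ ≤ 1 - d + d ^ 2 := by
      rw [inv_le_iff_one_le_mul₀ (by linarith)]
      nlinarith [pow_nonneg hd0 3]
    linarith
  set r := Complex.exp (-(z * L)) - 1 + z * L with hr
  have hzL : ‖z * (L : ℂ)‖ ≤ ‖z‖ * d := by
    rw [norm_mul, Complex.norm_real, Real.norm_of_nonneg hL0]; gcongr
  have hrb : ‖r‖ ≤ ‖z‖ ^ 2 * Real.exp ‖z‖ * d ^ 2 := by
    have := Complex.norm_exp_sub_sum_le_norm_mul_exp (-(z * L)) 2
    rw [show Complex.exp (-(z * L)) - ∑ m ∈ Finset.range 2, (-(z * L)) ^ m / (m.factorial : ℂ) = r by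
      simp [Finset.sum_range_succ, hr]; ring, norm_neg] at this
    calc ‖r‖ ≤ _ := this
      _ ≤ (‖z‖ * d) ^ 2 * Real.exp ‖z‖ := by
        gcongr
        exact hzL.trans (mul_le_of_le_one_right (norm_nonneg _) hd1)
      _ = _ := by ring
  have hrb' : ‖r‖ ≤ ‖z‖ ^ 2 * Real.exp ‖z‖ * d :=
    hrb.trans (by gcongr; nlinarith)
  have key : eulerFactor z A d - 1 =
      (A - z) * d + z * ((d - L : ℝ) : ℂ) + r + d * A * (r - z * L) := by
    have : Complex.exp (-(z * L)) = r + 1 - z * L := by rw [hr]; ring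
    rw [eulerFactor, ← hL, this]; push_cast; ring
  rw [key]
  have h1 : ‖(A - z) * d‖ ≤ ‖A - z‖ * d := by
    rw [norm_mul, Complex.norm_real, Real.norm_of_nonneg hd0]
  have h2 : ‖z * ((d - L : ℝ) : ℂ)‖ ≤ ‖z‖ * d ^ 2 := by
    rw [norm_mul, Complex.norm_real, Real.norm_of_nonneg (by linarith)]; gcongr
  have h3 : ‖d * A * (r - z * L)‖ ≤
      d * (‖z‖ + 1) * (‖z‖ ^ 2 * Real.exp ‖z‖ * d + ‖z‖ * d) := by
    rw [norm_mul, norm_mul, Complex.norm_real, Real.norm_of_nonneg hd0]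
    gcongr
    exact (norm_sub_le _ _).trans (add_le_add hrb' hzL)
  refine (norm_add_le _ _).trans ?_
  refine (add_le_add ((norm_add_le _ _).trans (add_le_add (norm_add_le _ _) le_rfl)) le_rfl).trans ?_
  linarith

lemma qStep_pos {h n : ℝ} (hh : 0 < h) (hn : 0 < n) : 0 < qStep h n := by
  have h1 : Real.exp (-h) < 1 := by simpa using hh
  have h2 : 1 < Real.exp (h * n) := Real.one_lt_exp_iff.2 (by positivity)
  exact div_pos (by linarith) (by linarith)

lemma qStep_le_inv {h n : ℝ} (hh : 0 < h) (hn : 0 < n) : qStep h n ≤ 1 / n := by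
  have h1 := Real.add_one_le_exp (-h)
  have h2 := Real.add_one_le_exp (h * n)
  have hp : 0 < h * n := by positivity
  rw [qStep, div_le_div_iff₀ (by linarith) hn]
  nlinarith

lemma mul_qStep_le {h n : ℝ} (hh : 0 < h) (hn : 0 < n) : h * qStep h n ≤ 2 / n ^ 2 := by
  have h1 := Real.add_one_le_exp (-h)
  have hp : 0 < h * n := by positivity
  have h2 := Real.quadratic_le_exp_of_nonneg hp.le
  rw [qStep, mul_div_assoc', div_le_div_iff₀ (by nlinarith) (by positivity)]
  calc h * (1 - Real.exp (-h)) * n ^ 2 ≤ h * h * n ^ 2 := by gcongr; linarith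
    _ ≤ 2 * (Real.exp (h * n) - 1) := by nlinarith

lemma norm_qNumber_sub_le {z : ℂ} {h : ℝ} (hh : 0 < h) (h1 : h ≤ 1) (hz : h * ‖z‖ ≤ 1) :
    ‖qNumber z h - z‖ ≤ 2 * (‖z‖ ^ 2 + ‖z‖) * h := by
  have hn1 : ‖-((h : ℂ) * z)‖ = h * ‖z‖ := by
    rw [norm_neg, norm_mul, Complex.norm_real, Real.norm_of_nonneg hh.le]
  have hn2 : ‖-(h : ℂ)‖ = h := by
    rw [norm_neg, Complex.norm_real, Real.norm_of_nonneg hh.le]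
  have e1 := Complex.norm_exp_sub_one_sub_id_le (hn1.trans_le hz)
  have e2 := Complex.norm_exp_sub_one_sub_id_le (hn2.trans_le h1)
  rw [hn1] at e1
  rw [hn2] at e2
  have hpos : h / 2 ≤ 1 - Real.exp (-h) := by
    have := Real.add_one_le_exp h
    have : Real.exp (-h) ≤ (1 + h)⁻¹ := by
      rw [Real.exp_neg]; exact inv_anti₀ (by linarith) (by linarith)
    have : (1 + h)⁻¹ ≤ 1 - h / 2 := by
      rw [inv_le_iff_one_le_mul₀ (by linarith)]; nlinarith
    linarith
  have hden : (1 - Complex.exp (-h)) = ((1 - Real.exp (-h) : ℝ) : ℂ) := by push_cast; rfl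
  have hne : (1 - Complex.exp (-h)) ≠ 0 := by
    rw [hden]; exact_mod_cast (show 1 - Real.exp (-h) ≠ 0 by linarith)
  rw [qNumber, div_sub' hne, norm_div, hden, Complex.norm_real,
    Real.norm_of_nonneg (by linarith : 0 ≤ 1 - Real.exp (-h)), div_le_iff₀ (by linarith), ← hden]
  have hnum : 1 - Complex.exp (-(h * z)) - (1 - Complex.exp (-h)) * z =
      z * (Complex.exp (-h) - 1 - -h) - (Complex.exp (-(h * z)) - 1 - -(h * z)) := by ring
  rw [hnum]
  calc _ ≤ ‖z‖ * h ^ 2 + (h * ‖z‖) ^ 2 := by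
        refine (norm_sub_le _ _).trans (add_le_add ?_ e1)
        rw [norm_mul]; gcongr
    _ = 2 * (‖z‖ ^ 2 + ‖z‖) * h * (h / 2) := by ring
    _ ≤ _ := by gcongr

lemma eventually_norm_qNumber_sub_le (z : ℂ) :
    ∀ᶠ h : ℝ in 𝓝[>] 0, ‖qNumber z h - z‖ ≤ 2 * (‖z‖ ^ 2 + ‖z‖) * h := by
  have h1 : ∀ᶠ h : ℝ in 𝓝[>] 0, h < 1 := nhdsWithin_le_nhds (Iio_mem_nhds one_pos)
  have h2 : ∀ᶠ h : ℝ in 𝓝[>] 0, h * ‖z‖ < 1 :=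
    nhdsWithin_le_nhds <| (show Continuous fun h : ℝ => h * ‖z‖ by fun_prop).continuousAt.eventually
      (Iio_mem_nhds (by simp))
  filter_upwards [h1, h2, self_mem_nhdsWithin] with h h1 h2 hh
  exact norm_qNumber_sub_le hh h1.le h2.le

lemma tendsto_qNumber (z : ℂ) : Tendsto (qNumber z) (𝓝[>] 0) (𝓝 z) := by
  rw [tendsto_iff_norm_sub_tendsto_zero]
  refine squeeze_zero' (Eventually.of_forall fun _ => norm_nonneg _)
    (eventually_norm_qNumber_sub_le z) ?_
  refine tendsto_nhdsWithin_of_tendsto_nhds ?_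
  exact Continuous.tendsto' (by fun_prop) _ _ (by simp)

lemma tendsto_qStep {n : ℝ} (hn : n ≠ 0) :
    Tendsto (fun h => qStep h n) (𝓝[>] 0) (𝓝 (1 / n)) := by
  have key (c : ℝ) : Tendsto (fun h : ℝ => h⁻¹ * (Real.exp (h * c) - 1)) (𝓝[>] 0) (𝓝 c) := by
    have : HasDerivAt (fun h : ℝ => Real.exp (h * c)) c 0 := by
      simpa using ((hasDerivAt_id (0 : ℝ)).mul_const c).exp
    simpa using this.tendsto_slope_zero_right
  have h := (key (-1)).neg.div (key n) hn
  rw [neg_neg] at h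
  refine h.congr' ?_
  filter_upwards [self_mem_nhdsWithin] with t ht
  have ht : t ≠ 0 := ne_of_gt ht
  simp only [Pi.div_apply, qStep, mul_neg, mul_one]
  rw [show -(t⁻¹ * (Real.exp (-t) - 1)) = t⁻¹ * (1 - Real.exp (-t)) by ring,
    mul_div_mul_left _ _ (inv_ne_zero ht)]

lemma tendsto_eulerFactor (z : ℂ) {n : ℝ} (hn : 0 < n) :
    Tendsto (fun h => eulerFactor z (qNumber z h) (qStep h n)) (𝓝[>] 0)
      (𝓝 (eulerFactor z z (1 / n))) := by
  have hd := tendsto_qStep hn.ne'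
  have hdc := (Complex.continuous_ofReal.tendsto _).comp hd
  have hl := (Complex.continuous_ofReal.tendsto _).comp
    ((hd.const_add 1).log (by positivity))
  exact ((hdc.mul (tendsto_qNumber z)).const_add 1).mul
    ((Complex.continuous_exp.tendsto _).comp (hl.const_mul z).neg)

lemma summable_const_div_add_one_sq (C : ℝ) : Summable fun k : ℕ => C / ((k : ℝ) + 1) ^ 2 := by
  have := (summable_nat_add_iff 1).2 (Real.summable_one_div_nat_pow.2 one_lt_two)
  simpa [div_eq_mul_inv] using this.mul_left C

lemma exists_eulerFactor_bound (z : ℂ) :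
    ∃ C : ℝ, ∀ᶠ h : ℝ in 𝓝[>] 0, ∀ k : ℕ,
      ‖eulerFactor z (qNumber z h) (qStep h (k + 1)) - 1‖ ≤ C / ((k : ℝ) + 1) ^ 2 := by
  set M := ‖z‖ + ‖z‖ ^ 2 * Real.exp ‖z‖ + (‖z‖ + 1) * (‖z‖ + ‖z‖ ^ 2 * Real.exp ‖z‖) with hM
  have hM0 : 0 ≤ M := by positivity
  set B := 2 * (‖z‖ ^ 2 + ‖z‖) with hB
  have hB0 : 0 ≤ B := by positivity
  refine ⟨B * 2 + M, ?_⟩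
  have hA : ∀ᶠ h : ℝ in 𝓝[>] 0, ‖qNumber z h‖ < ‖z‖ + 1 :=
    (tendsto_qNumber z).norm.eventually (Iio_mem_nhds (by linarith))
  filter_upwards [hA, eventually_norm_qNumber_sub_le z, self_mem_nhdsWithin] with h hA hz hh k
  have hh : 0 < h := hh
  have hk : (0 : ℝ) < k + 1 := by positivity
  have hd := qStep_le_inv hh hk
  have hd0 := (qStep_pos hh hk).le
  have hd1 : 1 / ((k : ℝ) + 1) ≤ 1 := by
    rw [div_le_one hk]; linarith [(Nat.cast_nonneg k : (0 : ℝ) ≤ k)]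
  refine (norm_eulerFactor_sub_one_le hd0 (hd.trans hd1) hA.le).trans ?_
  rw [← hM]
  calc _ ≤ B * h * qStep h (k + 1) + M * (1 / ((k : ℝ) + 1)) ^ 2 := by gcongr
    _ = B * (h * qStep h (k + 1)) + M * (1 / ((k : ℝ) + 1)) ^ 2 := by ring
    _ ≤ B * (2 / ((k : ℝ) + 1) ^ 2) + M * (1 / ((k : ℝ) + 1)) ^ 2 := by
      gcongr; exact mul_qStep_le hh hk
    _ = _ := by field_simp

lemma multipliable_of_norm_sub_one_le {f : ℕ → ℂ} {C : ℝ}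
    (hf : ∀ k : ℕ, ‖f k - 1‖ ≤ C / ((k : ℝ) + 1) ^ 2) : Multipliable f := by
  have := multipliable_one_add_of_summable (f := fun k => f k - 1)
    ((summable_const_div_add_one_sq C).of_nonneg_of_le (fun _ => norm_nonneg _) hf)
  simpa using this

lemma tendsto_tprod_eulerFactor (z : ℂ) :
    Tendsto (fun h : ℝ => ∏' k : ℕ, eulerFactor z (qNumber z h) (qStep h (k + 1))) (𝓝[>] 0)
      (𝓝 (∏' k : ℕ, eulerFactor z z (1 / (k + 1)))) := by
  obtain ⟨C, hC⟩ := exists_eulerFactor_bound z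
  have := tendsto_tprod_one_add_of_dominated_convergence (summable_const_div_add_one_sq C)
    (fun k : ℕ => (tendsto_eulerFactor z (by positivity : (0 : ℝ) < k + 1)).sub_const 1) hC
  simpa using this

lemma multipliable_eulerFactor (z : ℂ) :
    Multipliable fun k : ℕ => eulerFactor z z (1 / (k + 1)) := by
  obtain ⟨C, hC⟩ := exists_eulerFactor_bound z
  refine multipliable_of_norm_sub_one_le (C := C) fun k => ?_
  exact le_of_tendsto
    ((tendsto_eulerFactor z (by positivity : (0 : ℝ) < k + 1)).sub_const 1).norm
    (hC.mono fun h hh => hh k)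

lemma prod_range_eulerFactor (z : ℂ) (n : ℕ) :
    ∏ k ∈ Finset.range n, eulerFactor z z (1 / (k + 1)) =
      (∏ k ∈ Finset.range n, (z + (k + 1))) / n.factorial *
        Complex.exp (-(z * (Real.log (n + 1) : ℝ))) := by
  induction n with
  | zero => simp
  | succ n ih =>
    rw [Finset.prod_range_succ, ih, Finset.prod_range_succ, eulerFactor, Nat.factorial_succ]
    have hn : (n : ℝ) + 1 ≠ 0 := by positivity
    have hlog : Real.log (1 + 1 / ((n : ℝ) + 1)) =
        Real.log ((n + 1 : ℕ) + 1) - Real.log (n + 1) := by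
      rw [← Real.log_div (by positivity) hn]; congr 1; push_cast; field_simp
    have hexp : Complex.exp (-(z * (Real.log ((n + 1 : ℕ) + 1) : ℝ))) =
        Complex.exp (-(z * (Real.log (n + 1) : ℝ))) *
        Complex.exp (-(z * (Real.log (1 + 1 / ((n : ℝ) + 1)) : ℝ))) := by
      rw [← Complex.exp_add, hlog]; congr 1; push_cast; ring
    rw [hexp]
    have hn' : (n : ℂ) + 1 ≠ 0 := by exact_mod_cast Nat.succ_ne_zero n
    have hf : (n.factorial : ℂ) ≠ 0 := by exact_mod_cast n.factorial_ne_zero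
    push_cast
    field_simp
    ring

lemma mul_tprod_eulerFactor (z : ℂ) (hz : ∀ m : ℕ, z ≠ -(m : ℂ)) :
    z * ∏' k : ℕ, eulerFactor z z (1 / (k + 1)) = (Complex.Gamma z)⁻¹ := by
  have h1 := (multipliable_eulerFactor z).tendsto_prod_tprod_nat.const_mul z
  have h2 := (Complex.GammaSeq_tendsto_Gamma z).inv₀ (Complex.Gamma_ne_zero hz)
  have h3 : Tendsto (fun n : ℕ => Complex.exp (-(z * (Real.log (1 + 1 / (n : ℝ)) : ℝ)))) atTop
      (𝓝 1) := by
    have ha : Tendsto (fun n : ℕ => 1 + 1 / (n : ℝ)) atTop (𝓝 1) := by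
      simpa using (tendsto_one_div_atTop_nhds_zero_nat (𝕜 := ℝ)).const_add 1
    have hb := (Complex.continuous_ofReal.tendsto _).comp (ha.log one_ne_zero)
    simpa [Function.comp_def] using (Complex.continuous_exp.tendsto _).comp (hb.const_mul z).neg
  have h4 := h2.mul h3
  rw [mul_one] at h4
  refine tendsto_nhds_unique h1 (h4.congr' ?_)
  filter_upwards [eventually_ne_atTop 0] with n hn
  have hnR : (n : ℝ) ≠ 0 := by exact_mod_cast hn
  have hnC : (n : ℂ) ≠ 0 := by exact_mod_cast hn
  have hlog : Real.log (1 + 1 / (n : ℝ)) = Real.log (n + 1) - Real.log n := by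
    rw [← Real.log_div (by positivity) hnR]; congr 1; field_simp
  rw [prod_range_eulerFactor, Complex.GammaSeq, Finset.prod_range_succ',
    Complex.cpow_def_of_ne_zero hnC, ← Complex.natCast_log, hlog]
  have hexp : Complex.exp (-(z * (Real.log (n + 1) : ℝ))) =
      (Complex.exp (Real.log n * z))⁻¹ *
        Complex.exp (-(z * (Real.log (n + 1) - Real.log n : ℝ))) := by
    rw [← Complex.exp_neg, ← Complex.exp_add]; congr 1; push_cast; ring
  rw [hexp]
  push_cast
  rw [add_zero, inv_div]
  ring

lemma one_sub_exp_neg_pos {t : ℝ} (ht : 0 < t) : 0 < 1 - Real.exp (-t) := by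
  have : Real.exp (-t) < 1 := by simpa using ht
  linarith

lemma one_sub_cexp_neg_ne_zero {t : ℝ} (ht : 0 < t) : 1 - Complex.exp (-t) ≠ 0 := by
  have := (one_sub_exp_neg_pos ht).ne'
  exact_mod_cast this

lemma prod_range_eulerFactor_qStep (z : ℂ) {h : ℝ} (hh : 0 < h) (n : ℕ) :
    ∏ k ∈ Finset.range n, eulerFactor z (qNumber z h) (qStep h (k + 1)) =
      (∏ k ∈ Finset.range n, (1 - Complex.exp (-(h * z)) * Complex.exp (-h) ^ (k + 1))) /
      (∏ k ∈ Finset.range n, (1 - Complex.exp (-h) * Complex.exp (-h) ^ k)) *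
        Complex.exp (-(z * (Real.log (1 - Real.exp (-(h * (n + 1)))) -
          Real.log (1 - Real.exp (-h)) : ℝ))) := by
  induction n with
  | zero => simp
  | succ n ih =>
    rw [Finset.prod_range_succ, ih, Finset.prod_range_succ, Finset.prod_range_succ, eulerFactor]
    have p1 : 0 < 1 - Real.exp (-(h * (n + 1))) := one_sub_exp_neg_pos (by positivity)
    have p2 : 0 < 1 - Real.exp (-(h * ((n + 1 : ℕ) + 1))) := one_sub_exp_neg_pos (by positivity)
    have hpow : Complex.exp (-h) ^ (n + 1) = ((Real.exp (-(h * (n + 1))) : ℝ) : ℂ) := by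
      rw [← Complex.exp_nat_mul, Complex.ofReal_exp]; congr 1; push_cast; ring
    have hstep : qStep h (n + 1) =
        Real.exp (-(h * (n + 1))) * (1 - Real.exp (-h)) / (1 - Real.exp (-(h * (n + 1)))) := by
      have : Real.exp (h * (n + 1)) - 1 =
          (1 - Real.exp (-(h * (n + 1)))) / Real.exp (-(h * (n + 1))) := by
        rw [sub_div, div_self (Real.exp_ne_zero _), one_div, ← Real.exp_neg, neg_neg]
      rw [qStep, this, div_div_eq_mul_div, mul_comm]
    have hone : 1 + qStep h (n + 1) =
        (1 - Real.exp (-(h * ((n + 1 : ℕ) + 1)))) / (1 - Real.exp (-(h * (n + 1)))) := by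
      have : Real.exp (-(h * ((n + 1 : ℕ) + 1))) =
          Real.exp (-(h * (n + 1))) * Real.exp (-h) := by
        rw [← Real.exp_add]; congr 1; push_cast; ring
      rw [hstep, this]; field_simp; ring
    have hexp : Complex.exp (-(z * (Real.log (1 - Real.exp (-(h * ((n + 1 : ℕ) + 1)))) -
          Real.log (1 - Real.exp (-h)) : ℝ))) =
        Complex.exp (-(z * (Real.log (1 - Real.exp (-(h * (n + 1)))) -
          Real.log (1 - Real.exp (-h)) : ℝ))) *
        Complex.exp (-(z * (Real.log (1 + qStep h (n + 1)) : ℝ))) := by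
      rw [← Complex.exp_add, hone, Real.log_div p2.ne' p1.ne']; congr 1; push_cast; ring
    have hlin : 1 + (qStep h (n + 1) : ℂ) * qNumber z h =
        (1 - Complex.exp (-(h * z)) * Complex.exp (-h) ^ (n + 1)) /
          (1 - Complex.exp (-h) * Complex.exp (-h) ^ n) := by
      have c3 := one_sub_cexp_neg_ne_zero hh
      have c1 : (1 : ℂ) - ((Real.exp (-(h * (n + 1))) : ℝ) : ℂ) ≠ 0 := by exact_mod_cast p1.ne'
      rw [← pow_succ', hpow, hstep, qNumber]
      push_cast at c1 ⊢
      field_simp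
      ring
    rw [hexp, hlin, ← div_mul_div_comm]
    ring

lemma multipliable_qPoch (x : ℂ) {q : ℂ} (hq : ‖q‖ < 1) :
    Multipliable fun j : ℕ => 1 - x * q ^ j := by
  have : Summable fun j : ℕ => ‖-(x * q ^ j)‖ := by
    simpa using (summable_geometric_of_lt_one (norm_nonneg q) hq).mul_left ‖x‖
  simpa [sub_eq_add_neg] using multipliable_one_add_of_summable this

lemma qPoch_self_ne_zero {q : ℂ} (hq : ‖q‖ < 1) : qPoch q q ≠ 0 := by
  have : Summable fun j : ℕ => ‖-(q * q ^ j)‖ := by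
    simpa using (summable_geometric_of_lt_one (norm_nonneg q) hq).mul_left ‖q‖
  have := tprod_one_add_ne_zero_of_summable (f := fun j : ℕ => -(q * q ^ j)) (fun j hj => ?_) this
  · simpa [qPoch, sub_eq_add_neg] using this
  · have h1 : q ^ (j + 1) = 1 := by rw [pow_succ']; linear_combination -hj
    have h2 : ‖q‖ ^ (j + 1) < 1 := pow_lt_one₀ (norm_nonneg _) hq (by simp)
    rw [← norm_pow, h1] at h2
    simp at h2

lemma one_sub_mul_tprod_eulerFactor {z : ℂ} {h : ℝ} (hh : 0 < h)
    (hm : Multipliable fun k : ℕ => eulerFactor z (qNumber z h) (qStep h (k + 1))) :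
    (1 - Complex.exp (-(h * z))) * ∏' k : ℕ, eulerFactor z (qNumber z h) (qStep h (k + 1)) =
      qPoch (Complex.exp (-(h * z))) (Complex.exp (-h)) /
        qPoch (Complex.exp (-h)) (Complex.exp (-h)) *
        Complex.exp (z * (Real.log (1 - Real.exp (-h)) : ℝ)) := by
  have hq : ‖Complex.exp (-h)‖ < 1 := by
    rw [Complex.norm_exp]; simpa using hh
  have h1 := hm.tendsto_prod_tprod_nat.const_mul (1 - Complex.exp (-(h * z)))
  have h2 := (multipliable_qPoch (Complex.exp (-(h * z))) hq).tendsto_prod_tprod_nat.comp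
    (tendsto_add_atTop_nat 1)
  have h3 := (multipliable_qPoch (Complex.exp (-h)) hq).tendsto_prod_tprod_nat
  have h4 : Tendsto (fun n : ℕ => Complex.exp (-(z * (Real.log (1 - Real.exp (-(h * (n + 1)))) -
          Real.log (1 - Real.exp (-h)) : ℝ)))) atTop
      (𝓝 (Complex.exp (z * (Real.log (1 - Real.exp (-h)) : ℝ)))) := by
    have ha : Tendsto (fun n : ℕ => 1 - Real.exp (-(h * ((n : ℝ) + 1)))) atTop (𝓝 1) := by
      have : Tendsto (fun n : ℕ => h * ((n : ℝ) + 1)) atTop atTop :=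
        (tendsto_atTop_add_const_right _ 1 tendsto_natCast_atTop_atTop).const_mul_atTop hh
      simpa using (Real.tendsto_exp_neg_atTop_nhds_zero.comp this).const_sub 1
    have hb := (Complex.continuous_ofReal.tendsto _).comp
      ((ha.log one_ne_zero).sub_const (Real.log (1 - Real.exp (-h))))
    simpa [Function.comp_def] using (Complex.continuous_exp.tendsto _).comp (hb.const_mul z).neg
  refine tendsto_nhds_unique h1 (((h2.div h3 (qPoch_self_ne_zero hq)).mul h4).congr fun n => ?_)
  rw [prod_range_eulerFactor_qStep z hh, Pi.div_apply, Function.comp_apply,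
    Finset.prod_range_succ']
  ring

lemma qGammaTrig_eq {z : ℂ} {h : ℝ} (hh : 0 < h)
    (hm : Multipliable fun k : ℕ => eulerFactor z (qNumber z h) (qStep h (k + 1))) :
    qGammaTrig z (Complex.I * ((h / (2 * Real.pi) : ℝ) : ℂ)) =
      (qNumber z h * ∏' k : ℕ, eulerFactor z (qNumber z h) (qStep h (k + 1)))⁻¹ := by
  have hpi : (Real.pi : ℂ) ≠ 0 := by exact_mod_cast Real.pi_ne_zero
  have hτ : 2 * Real.pi * Complex.I * (Complex.I * ((h / (2 * Real.pi) : ℝ) : ℂ)) = -(h : ℂ) := by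
    push_cast
    field_simp
    rw [Complex.I_sq]
    ring
  have hden := one_sub_cexp_neg_ne_zero hh
  have hpow : (1 - Complex.exp (-h)) ^ (1 - z) = (1 - Complex.exp (-h)) *
      (Complex.exp (z * (Real.log (1 - Real.exp (-h)) : ℝ)))⁻¹ := by
    rw [Complex.cpow_sub _ _ hden, Complex.cpow_one, Complex.cpow_def_of_ne_zero hden,
      Complex.ofReal_log (one_sub_exp_neg_pos hh).le, div_eq_mul_inv]
    push_cast
    rw [mul_comm z]
  have hnum : qNumber z h = (1 - Complex.exp (-(h * z))) / (1 - Complex.exp (-h)) := rfl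
  have key := one_sub_mul_tprod_eulerFactor hh hm
  generalize ∏' k : ℕ, eulerFactor z (qNumber z h) (qStep h (k + 1)) = P at key ⊢
  rw [qGammaTrig, hτ, hpow, hnum, div_mul_eq_mul_div, key, neg_mul, inv_div, div_eq_mul_inv _ (_ * _),
    mul_inv, inv_div]
  ring

/-- the rational limit `Γ_trig(z, is) → Γ(z)` as `s → 0⁺`. -/
theorem qGammaTrig_tendsto_Gamma (z : ℂ) (hz : ∀ m : ℕ, z ≠ -(m : ℂ)) :
    Tendsto (fun s : ℝ => qGammaTrig z (Complex.I * (s : ℂ)))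
      (nhdsWithin 0 (Set.Ioi 0)) (nhds (Complex.Gamma z)) := by
  obtain ⟨C, hC⟩ := exists_eulerFactor_bound z
  have hlim := ((tendsto_qNumber z).mul (tendsto_tprod_eulerFactor z)).inv₀
    (by rw [mul_tprod_eulerFactor z hz]; exact inv_ne_zero (Complex.Gamma_ne_zero hz))
  rw [mul_tprod_eulerFactor z hz, inv_inv] at hlim
  have hscale : Tendsto (fun s : ℝ => 2 * Real.pi * s) (𝓝[>] 0) (𝓝[>] 0) := by
    refine tendsto_nhdsWithin_iff.2 ⟨tendsto_nhdsWithin_of_tendsto_nhds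
      (Continuous.tendsto' (by fun_prop) _ _ (by simp)), ?_⟩
    filter_upwards [self_mem_nhdsWithin] with s hs
    exact mul_pos Real.two_pi_pos hs
  refine (hlim.comp hscale).congr' ?_
  filter_upwards [hscale.eventually hC, hscale.eventually self_mem_nhdsWithin] with s hs hpos
  rw [Function.comp_apply, ← qGammaTrig_eq hpos (multipliable_of_norm_sub_one_le hs),
    mul_div_cancel_left₀ _ Real.two_pi_pos.ne']
end
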